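/- Let A be a densely defined closed linear operator in a complex Hilbert space H with D(A) ⊆ D(A*), and let λ ∈ ∂Num(A) (a boundary point of the closure of the numerical range). Then ker(A − λ) ⊆ ker(A* − λ̄). -/

import Mathlib

open scoped InnerProductSpace

/-- The numerical range `Num(A) = {⟨Af, f⟩ : f ∈ D(A), ‖f‖ = 1}` of a (partially
defined) linear operator `A` in a complex Hilbert space `H`.  (Here `⟪f, A f⟫_ℂ` is
Mathlib's inner product, conjugate-linear in the first variable, so it equals the
paper's `⟨Af, f⟩`, which is linear in the first variable.) -/
noncomputable def NumRange {H : Type*} [NormedAddCommGroup H] [InnerProductSpace ℂ H]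
    (A : H →ₗ.[ℂ] H) : Set ℂ :=
  {z : ℂ | ∃ f : A.domain, ‖(f : H)‖ = 1 ∧ z = ⟪(f : H), A f⟫_ℂ}

/-- A quotient whose numerator is `c * t` to first order at `0`, with `c ≠ 0`, and whose
denominator does not vanish at `0`, maps neighbourhoods of `0` onto neighbourhoods of its value. -/
theorem map_nhds_zero_add_div_eq (l c d a b b' e : ℂ) (hc : c ≠ 0) (ha : a ≠ 0) :
    Filter.map (fun t : ℂ => l + (t * c + t * (starRingEnd ℂ) t * d) /
      (a + t * b + (starRingEnd ℂ) t * b' + t * (starRingEnd ℂ) t * e)) (nhds 0) = nhds l := by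
  have hid : HasStrictFDerivAt (fun t : ℂ => t) (ContinuousLinearMap.id ℝ ℂ) 0 :=
    hasStrictFDerivAt_id 0
  have hconj : HasStrictFDerivAt (fun t : ℂ => (starRingEnd ℂ) t)
      (Complex.conjCLE : ℂ →L[ℝ] ℂ) 0 :=
    (Complex.conjCLE : ℂ →L[ℝ] ℂ).hasStrictFDerivAt
  have hnum := (hid.mul_const c).add ((hid.mul hconj).mul_const d)
  have hconjC : ContDiff ℝ 1 (fun t : ℂ => (starRingEnd ℂ) t) :=
    (Complex.conjCLE : ℂ →L[ℝ] ℂ).contDiff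
  have hden : ContDiffAt ℝ 1 (fun t : ℂ =>
      (a + t * b + (starRingEnd ℂ) t * b' + t * (starRingEnd ℂ) t * e)⁻¹) 0 := by
    refine ContDiffAt.inv (ContDiff.contDiffAt ?_) (by simpa using ha)
    fun_prop
  have hquot := (hnum.mul (hden.hasStrictFDerivAt one_ne_zero)).const_add l
  have hmap := hquot.map_nhds_eq_of_surj (by
    rw [LinearMap.range_eq_top]
    intro y
    refine ⟨y * a / c, ?_⟩
    simp
    field_simp)
  simpa [div_eq_mul_inv] using hmap

/-- If `f ≠ 0` satisfies `A f = l • f` and `⟪f, A g⟫ ≠ l * ⟪f, g⟫` for some `g` in the domain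
of `A`, then `l` is an interior point of the numerical range of `A`. -/
theorem numRange_mem_nhds_of_inner_ne {H : Type*} [NormedAddCommGroup H] [InnerProductSpace ℂ H]
    (A : H →ₗ.[ℂ] H) {l : ℂ} {f g : A.domain} (hf : (f : H) ≠ 0) (hAf : A f = l • (f : H))
    (hg : ⟪(f : H), A g⟫_ℂ ≠ l * ⟪(f : H), (g : H)⟫_ℂ) : NumRange A ∈ nhds l := by
  rw [← map_nhds_zero_add_div_eq l (⟪(f : H), A g⟫_ℂ - l * ⟪(f : H), (g : H)⟫_ℂ)
    (⟪(g : H), A g⟫_ℂ - l * ⟪(g : H), (g : H)⟫_ℂ) ⟪(f : H), (f : H)⟫_ℂ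
    ⟪(f : H), (g : H)⟫_ℂ ⟪(g : H), (f : H)⟫_ℂ ⟪(g : H), (g : H)⟫_ℂ
    (sub_ne_zero.mpr hg) (inner_self_ne_zero.mpr hf), Filter.mem_map]
  have hcont : Continuous (fun t : ℂ => (f : H) + t • (g : H)) := by fun_prop
  have hne : ∀ᶠ t in nhds (0 : ℂ), (f : H) + t • (g : H) ≠ 0 :=
    hcont.continuousAt.eventually_ne (by simpa using hf)
  filter_upwards [hne] with t ht
  have hnorm : (‖(f : H) + t • (g : H)‖ : ℂ) ≠ 0 := by simpa using ht
  refine ⟨((‖(f : H) + t • (g : H)‖ : ℂ)⁻¹) • (f + t • g), ?_, ?_⟩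
  · rw [Submodule.coe_smul, norm_smul, norm_inv, Complex.norm_real, norm_norm]
    exact inv_mul_cancel₀ (norm_ne_zero_iff.mpr ht)
  · have hself : ⟪(f : H), (f : H)⟫_ℂ + t * ⟪(f : H), (g : H)⟫_ℂ
        + (starRingEnd ℂ) t * ⟪(g : H), (f : H)⟫_ℂ
        + t * (starRingEnd ℂ) t * ⟪(g : H), (g : H)⟫_ℂ
        = (‖(f : H) + t • (g : H)‖ : ℂ) ^ 2 := by
      have h := inner_self_eq_norm_sq_to_K (𝕜 := ℂ) ((f : H) + t • (g : H))
      simp only [inner_add_left, inner_add_right, inner_smul_left, inner_smul_right] at h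
      refine Eq.trans ?_ h
      ring
    beta_reduce
    rw [hself]
    simp only [LinearPMap.map_smul, LinearPMap.map_add, Submodule.coe_smul, Submodule.coe_add,
      inner_smul_left, inner_smul_right, map_inv₀, Complex.conj_ofReal]
    field_simp
    rw [← hself]
    simp only [hAf, inner_add_left, inner_add_right, inner_smul_left, inner_smul_right]
    ring

/-- Lemma 3.9.  Let `A` be a densely defined closed linear operator in
a complex Hilbert space `H` with `D(A) ⊆ D(A*)`, and let `lam` be a boundary point of
the closure of the numerical range of `A`.  Then `ker(A - lam) ⊆ ker(A* - conj lam)`. -/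
theorem ker_subset_ker_adjoint_of_boundary
    {H : Type*} [NormedAddCommGroup H] [InnerProductSpace ℂ H] [CompleteSpace H]
    (A : H →ₗ.[ℂ] H) (hdense : Dense (A.domain : Set H)) (hAclosed : A.IsClosed)
    (hsub : A.domain ≤ A.adjoint.domain)
    (lam : ℂ) (hfr : lam ∈ frontier (closure (NumRange A))) :
    ∀ f : A.domain, A f = lam • (f : H) →
      A.adjoint ⟨(f : H), hsub f.2⟩ = (starRingEnd ℂ) lam • (f : H) := by
  intro f hf
  refine LinearPMap.adjoint_apply_eq hdense _ fun g => ?_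
  rw [inner_smul_left, Complex.conj_conj]
  by_contra hne
  have hf0 : (f : H) ≠ 0 := by
    intro h0
    simp [h0] at hne
  exact hfr.2 (interior_mono subset_closure
    (mem_interior_iff_mem_nhds.mpr (numRange_mem_nhds_of_inner_ne A hf0 hf (Ne.symm hne))))
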